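/- arXiv:2211.00678 — 2 statements merged into one kernel-verified Lean document; each statement's English description precedes it below -/
import Mathlib

section
/- Let V be a type, N a natural number, and α : {0,…,N} → V a sequence of points. Let I be a finite index set; for each i ∈ I let d_i be an ℕ-valued pseudometric on V satisfying d_i(α_k, α_{k+1}) ≤ 1 for all 0 ≤ k < N. Suppose that for each ordered pair (i,j) with i ≠ j there is a point p_{ij} ∈ V such that the Behrstock inequality min{ d_i(α_k, p_{ij}), d_j(α_k, p_{ji}) } ≤ 10 holds for all 0 ≤ k ≤ N. If d_i(α_0, α_N) ≥ 53 for every i ∈ I, then ∑_{i ∈ I} d_i(α_0, α_N) ≤ 5·N. -/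
/-- Effective lower bound on distance (Prop. in the paper).
`V` a type, `N : ℕ`, `α : ℕ → V` a sequence (indices `0,…,N` are used).
`I` a finite index set; for each `i ∈ I`, `d i` is an ℕ-valued pseudometric on `V`
with `d i (α k) (α (k+1)) ≤ 1` for `0 ≤ k < N`.  For each ordered pair `(i,j)`,
`i ≠ j`, there is a point `p i j ∈ V` such that the Behrstock inequality
`min (d i (α k) (p i j)) (d j (α k) (p j i)) ≤ 10` holds for all `0 ≤ k ≤ N`.
If `d i (α 0) (α N) ≥ 53` for every `i ∈ I`, then `∑ i ∈ I, d i (α 0) (α N) ≤ 5·N`. -/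
theorem stmt0 {V ι : Type*} (N : ℕ) (α : ℕ → V) (I : Finset ι)
    (d : ι → V → V → ℕ)
    (hrefl : ∀ i ∈ I, ∀ x, d i x x = 0)
    (hsymm : ∀ i ∈ I, ∀ x y, d i x y = d i y x)
    (htri : ∀ i ∈ I, ∀ x y z, d i x z ≤ d i x y + d i y z)
    (hstep : ∀ i ∈ I, ∀ k < N, d i (α k) (α (k + 1)) ≤ 1)
    (p : ι → ι → V)
    (hBehrstock : ∀ i ∈ I, ∀ j ∈ I, i ≠ j →
      ∀ k ≤ N, min (d i (α k) (p i j)) (d j (α k) (p j i)) ≤ 10)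
    (hbig : ∀ i ∈ I, 53 ≤ d i (α 0) (α N)) :
    ∑ i ∈ I, d i (α 0) (α N) ≤ 5 * N := by
  classical
  set S : ι → Finset ℕ := fun i => (Finset.range N).filter
    (fun k => 20 < d i (α 0) (α k) ∧ 20 < d i (α k) (α N)) with hS
  have key : ∀ i ∈ I, ∀ j ∈ I, i ≠ j → ∀ k, k ∈ S i → ¬ d i (α k) (p i j) ≤ 10 := by
    intro i hi j hj hij k hk h
    simp only [hS, Finset.mem_filter, Finset.mem_range] at hk
    have h0 := hBehrstock i hi j hj hij 0 (Nat.zero_le _)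
    have hN := hBehrstock i hi j hj hij N le_rfl
    have t1 := htri i hi (α 0) (p i j) (α k)
    have t2 := htri i hi (α k) (p i j) (α N)
    have s1 := hsymm i hi (p i j) (α k)
    have s2 := hsymm i hi (p i j) (α N)
    have t3 := htri j hj (α 0) (p j i) (α N)
    have s3 := hsymm j hj (p j i) (α N)
    have b := hbig j hj
    rw [min_le_iff] at h0 hN
    omega
  have hdisj : (I : Set ι).PairwiseDisjoint S := by
    intro i hi j hj hij
    refine Finset.disjoint_left.mpr fun k hki hkj => ?_
    have hkN : k ≤ N := by
      simp only [hS, Finset.mem_filter, Finset.mem_range] at hki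
      omega
    rcases min_le_iff.mp (hBehrstock i hi j hj hij k hkN) with h | h
    · exact key i hi j hj hij k hki h
    · exact key j hj i hi hij.symm k hkj h
  have hcard : ∀ i ∈ I, d i (α 0) (α N) ≤ 5 * (S i).card := by
    intro i hi
    have hsub : Finset.Icc 21 (d i (α 0) (α N) - 21) ⊆
        (S i).image (fun k => d i (α 0) (α k)) := by
      intro v hv
      rw [Finset.mem_Icc] at hv
      have b := hbig i hi
      have hex : ∃ k, v ≤ d i (α 0) (α k) := ⟨N, by omega⟩
      have hle : Nat.find hex ≤ N := Nat.find_min' hex (by omega)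
      have hsp := Nat.find_spec hex
      have hmin := fun m => @Nat.find_min _ _ hex m
      generalize Nat.find hex = k at hle hsp hmin
      have hval : d i (α 0) (α k) = v := by
        cases k with
        | zero => rw [hrefl i hi] at hsp; omega
        | succ m =>
          have h1 := hmin m (Nat.lt_succ_self m)
          have h2 := hstep i hi m (by omega)
          have h3 := htri i hi (α 0) (α m) (α (m + 1))
          omega
      have hne : k ≠ N := by
        rintro rfl
        omega
      have t := htri i hi (α 0) (α k) (α N)
      refine Finset.mem_image.mpr ⟨k, ?_, hval⟩
      simp only [hS, Finset.mem_filter, Finset.mem_range]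
      omega
    have h1 := (Finset.card_le_card hsub).trans Finset.card_image_le
    rw [Nat.card_Icc] at h1
    have b := hbig i hi
    omega
  calc ∑ i ∈ I, d i (α 0) (α N) ≤ ∑ i ∈ I, 5 * (S i).card := Finset.sum_le_sum hcard
    _ = 5 * (I.biUnion S).card := by rw [← Finset.mul_sum, Finset.card_biUnion hdisj]
    _ ≤ 5 * (Finset.range N).card := by
        refine Nat.mul_le_mul_left 5 (Finset.card_le_card ?_)
        exact Finset.biUnion_subset.mpr fun i _ => Finset.filter_subset _ _
    _ = 5 * N := by rw [Finset.card_range]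
end

section
/- Let d₁ and d₂ be ℕ-valued pseudometrics on a type V, and let p₁₂, p₂₁ ∈ V. Let a, x, b ∈ V and suppose the Behrstock inequality min{ d₁(y, p₁₂), d₂(y, p₂₁) } ≤ 10 holds for each y ∈ {a, x, b}. If d₁(a,x) ≥ 21, d₁(x,b) ≥ 21, d₂(a,x) ≥ 21, and d₂(x,b) ≥ 21, then d₁(a,b) ≤ 20 or d₂(a,b) ≤ 20. -/
/-- The Claim in the proof of the distance lower bound:
no vertex `x` of a geodesic makes simultaneous large progress in two
overlapping subsurfaces. -/
theorem stmt1 {V : Type*} (d₁ d₂ : V → V → ℕ)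
    (hrefl₁ : ∀ x, d₁ x x = 0) (hsymm₁ : ∀ x y, d₁ x y = d₁ y x)
    (htri₁ : ∀ x y z, d₁ x z ≤ d₁ x y + d₁ y z)
    (hrefl₂ : ∀ x, d₂ x x = 0) (hsymm₂ : ∀ x y, d₂ x y = d₂ y x)
    (htri₂ : ∀ x y z, d₂ x z ≤ d₂ x y + d₂ y z)
    (p₁₂ p₂₁ a x b : V)
    (hBehrstock : ∀ y ∈ ({a, x, b} : Set V), min (d₁ y p₁₂) (d₂ y p₂₁) ≤ 10)
    (hax₁ : 21 ≤ d₁ a x) (hxb₁ : 21 ≤ d₁ x b)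
    (hax₂ : 21 ≤ d₂ a x) (hxb₂ : 21 ≤ d₂ x b) :
    d₁ a b ≤ 20 ∨ d₂ a b ≤ 20 := by
  have ha := hBehrstock a (by simp)
  have hx := hBehrstock x (by simp)
  have hb := hBehrstock b (by simp)
  have h1 := htri₁ a p₁₂ x
  have h2 := htri₁ x p₁₂ b
  have h3 := htri₁ a p₁₂ b
  have h4 := htri₂ a p₂₁ x
  have h5 := htri₂ x p₂₁ b
  have h6 := htri₂ a p₂₁ b
  rw [hsymm₁ p₁₂ x] at h1
  rw [hsymm₁ p₁₂ b] at h2 h3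
  rw [hsymm₂ p₂₁ x] at h4
  rw [hsymm₂ p₂₁ b] at h5 h6
  omega
end
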